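/- Let A be a concept name and R a role name with A ∈ Σ_C and R ∈ Σ_R, and let O be the DL-Lite ontology {A ⊑ ∃R, ∃R⁻ ⊑ A}. Then the concept A has no finite characterisation w.r.t. L(∃,−,⊓)[Σ_C,Σ_R] under O; in particular, L(∃,−,⊓) does not admit finite characterisations under O. -/

import Mathlib

namespace DL

/-! ### Syntax of ALCQI concepts -/

/-- Roles: role names (indexed by ℕ) and inverse roles. -/
inductive Role where
  | name : ℕ → Role
  | inv  : ℕ → Role
deriving DecidableEq

/-- ALCQI concept expressions. -/
inductive Concept where
  | atom : ℕ → Concept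
  | top  : Concept
  | bot  : Concept
  | and  : Concept → Concept → Concept
  | or   : Concept → Concept → Concept
  | neg  : Concept → Concept
  | ex   : Role → Concept → Concept
  | all  : Role → Concept → Concept
  | atLeast : ℕ → Role → Concept → Concept
deriving DecidableEq

/-- The operators/constructors that a concept language may use. -/
inductive Op where
  | all | ex | ge | inv | and | or | top | bot | neg
deriving DecidableEq

/-! ### Interpretations and semantics -/

/-- An interpretation: a nonempty domain, interpretations of concept names
and of role names. -/
structure Interp where
  Δ : Type
  dom_nonempty : Nonempty Δ
  atom : ℕ → Set Δ
  rel : ℕ → Δ → Δ → Prop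

def Role.sem (I : Interp) : Role → (I.Δ → I.Δ → Prop)
  | .name R => I.rel R
  | .inv R  => fun d e => I.rel R e d

def Concept.sem (I : Interp) : Concept → Set I.Δ
  | .atom A => I.atom A
  | .top => Set.univ
  | .bot => ∅
  | .and C D => C.sem I ∩ D.sem I
  | .or C D => C.sem I ∪ D.sem I
  | .neg C => (C.sem I)ᶜ
  | .ex S C => {d | ∃ e, S.sem I d e ∧ e ∈ C.sem I}
  | .all S C => {d | ∀ e, S.sem I d e → e ∈ C.sem I}
  | .atLeast k S C => {d | ∃ s : Finset I.Δ, s.card = k ∧ ∀ e ∈ s, S.sem I d e ∧ e ∈ C.sem I}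

/-! ### Concept languages L(Os)[SC, SR] -/

def Role.inSig (Os : Finset Op) (SR : Finset ℕ) : Role → Prop
  | .name R => R ∈ SR
  | .inv R  => Op.inv ∈ Os ∧ R ∈ SR

/-- Membership of a concept in the language `L(Os)[SC, SR]`. -/
def Concept.inLang (Os : Finset Op) (SC SR : Finset ℕ) : Concept → Prop
  | .atom A => A ∈ SC
  | .top => Op.top ∈ Os
  | .bot => Op.bot ∈ Os
  | .and C D => Op.and ∈ Os ∧ C.inLang Os SC SR ∧ D.inLang Os SC SR
  | .or C D => Op.or ∈ Os ∧ C.inLang Os SC SR ∧ D.inLang Os SC SR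
  | .neg C => Op.neg ∈ Os ∧ C.inLang Os SC SR
  | .ex S C => Op.ex ∈ Os ∧ S.inSig Os SR ∧ C.inLang Os SC SR
  | .all S C => Op.all ∈ Os ∧ S.inSig Os SR ∧ C.inLang Os SC SR
  | .atLeast k S C => Op.ge ∈ Os ∧ 1 ≤ k ∧ S.inSig Os SR ∧ C.inLang Os SC SR

/-! ### DL-Lite ontologies -/

/-- Basic concepts: concept names, ∃R and ∃R⁻. -/
inductive Basic where
  | atom : ℕ → Basic
  | ex : Role → Basic
deriving DecidableEq

def Basic.sem (I : Interp) : Basic → Set I.Δ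
  | .atom A => I.atom A
  | .ex S => {d | ∃ e, S.sem I d e}

/-- A DL-Lite concept inclusion `B ⊑ C` where `C` is a basic concept
(`negated = false`) or a negated basic concept (`negated = true`). -/
structure CI where
  lhs : Basic
  rhs : Basic
  negated : Bool
deriving DecidableEq

def CI.sat (I : Interp) (ci : CI) : Prop :=
  if ci.negated then ci.lhs.sem I ⊆ (ci.rhs.sem I)ᶜ else ci.lhs.sem I ⊆ ci.rhs.sem I

/-- A DL-Lite ontology: a finite set (list) of concept inclusions. -/
abbrev Ontology := List CI

def Interp.satO (I : Interp) (Ont : Ontology) : Prop := ∀ ci ∈ Ont, ci.sat I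

/-! ### Pointed interpretations, examples, characterisations -/

structure PInterp where
  I : Interp
  pt : I.Δ

/-- A pointed interpretation is finite if its domain is finite. -/
def PInterp.finite (P : PInterp) : Prop := Finite P.I.Δ

/-- `C` fits a collection `(Epos, Eneg)` of labelled examples. -/
def Fits (C : Concept) (Epos Eneg : List PInterp) : Prop :=
  (∀ e ∈ Epos, e.pt ∈ C.sem e.I) ∧ (∀ e ∈ Eneg, e.pt ∉ C.sem e.I)

/-- Equivalence of concepts. -/
def CEquiv (C D : Concept) : Prop := ∀ I : Interp, C.sem I = D.sem I

/-- Equivalence of concepts relative to an ontology. -/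
def CEquivO (Ont : Ontology) (C D : Concept) : Prop :=
  ∀ I : Interp, I.satO Ont → C.sem I = D.sem I

/-- `⊨ C ⊑ D`. -/
def Subsumes (C D : Concept) : Prop := ∀ I : Interp, C.sem I ⊆ D.sem I

/-- `Ont ⊨ C ⊑ D`. -/
def SubsumesO (Ont : Ontology) (C D : Concept) : Prop :=
  ∀ I : Interp, I.satO Ont → C.sem I ⊆ D.sem I

/-- `(Epos, Eneg)` is a finite characterisation of `C` w.r.t. the
concept language (predicate) `L`: all examples are finite, `C` fits,
and every fitting concept of `L` is equivalent to `C`. -/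
def FinChar (L : Concept → Prop) (C : Concept) (Epos Eneg : List PInterp) : Prop :=
  (∀ e ∈ Epos ++ Eneg, e.finite) ∧
  Fits C Epos Eneg ∧
  ∀ D, L D → Fits D Epos Eneg → CEquiv C D

/-- Finite characterisation of `C` w.r.t. `L` under an ontology `Ont`:
all examples are finite and satisfy `Ont`, `C` fits, and every fitting
concept of `L` is equivalent to `C` relative to `Ont`. -/
def FinCharO (Ont : Ontology) (L : Concept → Prop) (C : Concept)
    (Epos Eneg : List PInterp) : Prop :=
  (∀ e ∈ Epos ++ Eneg, e.finite ∧ e.I.satO Ont) ∧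
  Fits C Epos Eneg ∧
  ∀ D, L D → Fits D Epos Eneg → CEquivO Ont C D

/-- `L(Os)` admits finite characterisations. -/
def AdmitsFinChar (Os : Finset Op) : Prop :=
  ∀ SC SR : Finset ℕ, ∀ C : Concept, C.inLang Os SC SR →
    ∃ Epos Eneg : List PInterp, FinChar (Concept.inLang Os SC SR) C Epos Eneg

/-- `L(Os)` admits finite characterisations under the ontology `Ont`. -/
def AdmitsFinCharO (Os : Finset Op) (Ont : Ontology) : Prop :=
  ∀ SC SR : Finset ℕ, ∀ C : Concept, C.inLang Os SC SR →
    ∃ Epos Eneg : List PInterp, FinCharO Ont (Concept.inLang Os SC SR) C Epos Eneg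

/-! ### Size, role depth, number restrictions -/

/-- Number of symbols of a concept expression (numbers in binary). -/
def Concept.size : Concept → ℕ
  | .atom _ => 1
  | .top => 1
  | .bot => 1
  | .and C D => C.size + D.size + 1
  | .or C D => C.size + D.size + 1
  | .neg C => C.size + 1
  | .ex _ C => C.size + 2
  | .all _ C => C.size + 2
  | .atLeast k _ C => C.size + 2 + Nat.size k

/-- Role depth of a concept. -/
def Concept.dp : Concept → ℕ
  | .atom _ => 0
  | .top => 0
  | .bot => 0
  | .and C D => max C.dp D.dp
  | .or C D => max C.dp D.dp
  | .neg C => C.dp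
  | .ex _ C => C.dp + 1
  | .all _ C => C.dp + 1
  | .atLeast _ _ C => C.dp + 1

/-- The largest number occurring in a number restriction of `C` (0 if none). -/
def Concept.nr : Concept → ℕ
  | .atom _ => 0
  | .top => 0
  | .bot => 0
  | .and C D => max C.nr D.nr
  | .or C D => max C.nr D.nr
  | .neg C => C.nr
  | .ex _ C => C.nr
  | .all _ C => C.nr
  | .atLeast k _ C => max k C.nr

/-- The DL-Lite ontology `{A ⊑ ∃R, ∃R⁻ ⊑ A}`. -/
def invOnt (A R : ℕ) : Ontology :=
  [⟨Basic.atom A, Basic.ex (Role.name R), false⟩,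
   ⟨Basic.ex (Role.inv R), Basic.atom A, false⟩]

/-- The `n`-fold existential restriction `∃S.∃S.….∃S.C`. -/
def Concept.exIter (S : Role) (n : ℕ) (C : Concept) : Concept := (Concept.ex S)^[n] C

theorem Concept.exIter_succ (S : Role) (n : ℕ) (C : Concept) :
    C.exIter S (n + 1) = .ex S (C.exIter S n) :=
  Function.iterate_succ_apply' _ _ _

theorem Concept.inLang_exIter {Os : Finset Op} {SC SR : Finset ℕ} {S : Role} {C : Concept}
    (hex : Op.ex ∈ Os) (hS : S.inSig Os SR) (hC : C.inLang Os SC SR) (n : ℕ) :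
    (C.exIter S n).inLang Os SC SR := by
  induction n with
  | zero => exact hC
  | succ n ih => rw [exIter_succ]; exact ⟨hex, hS, ih⟩

theorem Concept.mem_sem_exIter_of_path {I : Interp} {S : Role} {C : Concept} {n : ℕ}
    {s : ℕ → I.Δ} (hs : ∀ k < n, S.sem I (s k) (s (k + 1))) (hC : s n ∈ C.sem I) :
    s 0 ∈ (C.exIter S n).sem I := by
  induction n generalizing s with
  | zero => exact hC
  | succ n ih =>
    rw [exIter_succ]
    exact ⟨s 1, hs 0 n.succ_pos,
      ih (s := fun k => s (k + 1)) (fun k hk => hs (k + 1) (by omega)) hC⟩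

theorem satO_invOnt_iff {I : Interp} {A R : ℕ} :
    I.satO (invOnt A R) ↔
      (∀ d ∈ I.atom A, ∃ e, I.rel R d e) ∧ ∀ d e, I.rel R d e → e ∈ I.atom A := by
  simp only [Interp.satO, invOnt, List.forall_mem_cons, CI.sat, Basic.sem, Role.sem,
    Set.subset_def, Set.mem_ofPred_eq, List.not_mem_nil, false_implies, implies_true, and_true,
    Bool.false_eq_true, if_false, forall_exists_index]
  exact and_congr_right fun _ => forall_comm

/-- `∃R.….∃R.∃R⁻.….∃R⁻.A`, going `n` steps forward and then `n + 1` steps backward. -/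
def Concept.forthAndBack (A R n : ℕ) : Concept :=
  ((Concept.atom A).exIter (.inv R) (n + 1)).exIter (.name R) n

theorem Concept.eventually_mem_sem_forthAndBack {I : Interp} [Finite I.Δ] {A R : ℕ}
    (hI : I.satO (invOnt A R)) {d : I.Δ} (hd : d ∈ I.atom A) :
    ∀ᶠ n in Filter.atTop, d ∈ (forthAndBack A R n).sem I := by
  rw [satO_invOnt_iff] at hI
  obtain ⟨hsucc, hmem⟩ := hI
  have hstep : ∀ x : I.atom A, ∃ y : I.atom A, I.rel R x y := fun x => by
    obtain ⟨e, he⟩ := hsucc x x.2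
    exact ⟨⟨e, hmem _ _ he⟩, he⟩
  choose g hg using hstep
  set s : ℕ → I.atom A := fun k => g^[k] ⟨d, hd⟩ with hs
  have hrel : ∀ k, I.rel R (s k) (s (k + 1)) := fun k => by
    simp only [hs, Function.iterate_succ_apply']
    exact hg _
  obtain ⟨i, p, hp, hper⟩ : ∃ i p, 0 < p ∧ s (i + p) = s i := by
    obtain ⟨i, j, hij, h⟩ := Finite.exists_ne_map_eq_of_infinite s
    rcases hij.lt_or_gt with hlt | hlt
    · exact ⟨i, j - i, by omega, by rw [h]; congr 1; omega⟩
    · exact ⟨j, i - j, by omega, by rw [← h]; congr 1; omega⟩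
  filter_upwards [Filter.eventually_ge_atTop i] with n hn
  have hn_per : s (n + p) = s n := by
    obtain ⟨m, rfl⟩ := Nat.exists_eq_add_of_le' hn
    rw [add_assoc]
    simp only [hs] at hper ⊢
    rw [Function.iterate_add_apply, hper, ← Function.iterate_add_apply]
  refine mem_sem_exIter_of_path (s := fun k => (s k : I.Δ)) (fun k _ => hrel k) ?_
  rw [← hn_per]
  refine mem_sem_exIter_of_path (s := fun k => (s (n + p - k) : I.Δ)) (fun k hk => ?_) (s _).2
  have h := hrel (n + p - (k + 1))
  rwa [show n + p - (k + 1) + 1 = n + p - k by omega] at h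

/-- The infinite `R`-path `0 → 1 → 2 → …` for every role name `R`, with every concept name true
everywhere. -/
def ray : Interp where
  Δ := ℕ
  dom_nonempty := ⟨0⟩
  atom _ := Set.univ
  rel _ a b := b = a + 1

theorem ray_satO_invOnt (A R : ℕ) : ray.satO (invOnt A R) :=
  satO_invOnt_iff.2 ⟨fun d _ => ⟨Nat.succ d, rfl⟩, fun _ _ _ => trivial⟩

theorem mem_sem_exIter_name_ray {R n : ℕ} {C : Concept} {d : ℕ}
    (h : d ∈ (C.exIter (.name R) n).sem ray) : d + n ∈ C.sem ray := by
  induction n generalizing d with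
  | zero => exact h
  | succ n ih =>
    rw [Concept.exIter_succ] at h
    obtain ⟨e, he, h⟩ := h
    obtain rfl : e = d + 1 := he
    rw [Nat.add_comm n 1, ← Nat.add_assoc]
    exact ih h

theorem le_of_mem_sem_exIter_inv_ray {R n : ℕ} {C : Concept} {d : ℕ}
    (h : d ∈ (C.exIter (.inv R) n).sem ray) : n ≤ d := by
  induction n generalizing d with
  | zero => exact d.zero_le
  | succ n ih =>
    rw [Concept.exIter_succ] at h
    obtain ⟨e, he, h⟩ := h
    obtain rfl : d = Nat.succ e := he
    exact Nat.succ_le_succ (ih h)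

theorem zero_notMem_sem_forthAndBack_ray (A R n : ℕ) :
    (0 : ℕ) ∉ (Concept.forthAndBack A R n).sem ray := fun h => by
  have := le_of_mem_sem_exIter_inv_ray (mem_sem_exIter_name_ray h)
  omega

/-- **Theorem**: under the DL-Lite ontology `{A ⊑ ∃R, ∃R⁻ ⊑ A}` (with
`A ∈ SC`, `R ∈ SR`), the concept name `A` has no finite characterisation
w.r.t. `L(∃,−,⊓)[SC,SR]`; in particular `L(∃,−,⊓)` does not admit finite
characterisations under this ontology. -/
theorem no_finchar_under_invOnt (SC SR : Finset ℕ) (A R : ℕ)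
    (hA : A ∈ SC) (hR : R ∈ SR) :
    ¬ ∃ Epos Eneg : List PInterp,
      FinCharO (invOnt A R)
        (Concept.inLang ({Op.ex, Op.inv, Op.and} : Finset Op) SC SR)
        (Concept.atom A) Epos Eneg := by
  rintro ⟨Epos, Eneg, hex, ⟨hpos, hneg⟩, huniq⟩
  obtain ⟨n, hn⟩ : ∃ n, ∀ e ∈ Epos, e.pt ∈ (Concept.forthAndBack A R n).sem e.I := by
    refine Filter.Eventually.exists (f := Filter.atTop) ?_
    refine (Filter.eventually_all_finite Epos.finite_toSet).2 fun e he => ?_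
    obtain ⟨hfin, hsat⟩ := hex e (List.mem_append_left _ he)
    have : Finite e.I.Δ := hfin
    exact Concept.eventually_mem_sem_forthAndBack hsat (hpos e he)
  have hL : (Concept.forthAndBack A R n).inLang {Op.ex, Op.inv, Op.and} SC SR :=
    Concept.inLang_exIter (S := .name R) (by decide) hR
      (Concept.inLang_exIter (S := .inv R) (C := .atom A) (by decide) ⟨by decide, hR⟩ hA _) _
  have heq := huniq (.and (.atom A) (Concept.forthAndBack A R n)) ⟨by decide, hA, hL⟩
    ⟨fun e he => ⟨hpos e he, hn e he⟩, fun e he h => hneg e he h.1⟩ ray (ray_satO_invOnt A R)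
  have h0 : (0 : ℕ) ∈ (Concept.atom A).sem ray := trivial
  rw [heq] at h0
  exact zero_notMem_sem_forthAndBack_ray A R n h0.2

end DL
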